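/- There exists a constant C_n, depending only on n, with the following property (local Li–Yau gradient estimate in ℝⁿ). Let x ∈ ℝⁿ, t ∈ ℝ, R > 0, T > 0, and let u be a smooth positive solution of the heat equation Δ_x u = ∂_t u on the set Q_{R,T}(x,t) = {(y,s) : |y − x| ≤ R, t − T ≤ s ≤ t}. Then ( (1/2)·|∇u|²/u² − (∂_t u)/u )(x,t) ≤ C_n (1/R² + 1/T). -/

import Mathlib

open MeasureTheory Real

noncomputable section

/-- Spatial Laplacian of `f : ℝⁿ → ℝ` at `x` (sum of second partial derivatives). -/
def lap (n : ℕ) (f : EuclideanSpace ℝ (Fin n) → ℝ) (x : EuclideanSpace ℝ (Fin n)) : ℝ :=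
  ∑ i : Fin n, fderiv ℝ (fun y => fderiv ℝ f y (EuclideanSpace.single i 1)) x
    (EuclideanSpace.single i 1)

/-- `u` is a smooth ancient solution of the heat equation on `ℝⁿ × (-∞, 0]`:
it is smooth and satisfies `Δ_x u = ∂_t u` for all `t ≤ 0`. -/
def IsAncientHeat (n : ℕ) (u : EuclideanSpace ℝ (Fin n) × ℝ → ℝ) : Prop :=
  ContDiff ℝ (⊤ : ℕ∞) u ∧ ∀ (x : EuclideanSpace ℝ (Fin n)) (t : ℝ), t ≤ 0 →
    lap n (fun y => u (y, t)) x = deriv (fun s => u (x, s)) t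

/-- The parabolic cube `Q_{R,T}(x,t) = {(y,s) : |y − x| ≤ R, s ∈ [t−T, t]}`. -/
def QRT (n : ℕ) (x : EuclideanSpace ℝ (Fin n)) (t R T : ℝ) :
    Set (EuclideanSpace ℝ (Fin n) × ℝ) :=
  {p | dist p.1 x ≤ R ∧ p.2 ∈ Set.Icc (t - T) t}

open scoped ContDiff

section DirectionalDerivative

variable {E : Type*} [NormedAddCommGroup E] [NormedSpace ℝ E] {ι : Type*} [Fintype ι]
  {U : Set E} {f g : E → ℝ} {p v : E}

/-- The derivative of `f` in the fixed direction `v`, as a function of the base point. -/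
def dirDeriv (v : E) (f : E → ℝ) (p : E) : ℝ := fderiv ℝ f p v

lemma differentiableAt_of_smoothOn (hU : IsOpen U) (hf : ContDiffOn ℝ ∞ f U) (hp : p ∈ U) :
    DifferentiableAt ℝ f p :=
  (hf.contDiffAt (hU.mem_nhds hp)).differentiableAt (by simp)

lemma dirDeriv_smoothOn (hU : IsOpen U) (hf : ContDiffOn ℝ ∞ f U) (v : E) :
    ContDiffOn ℝ ∞ (dirDeriv v f) U :=
  (hf.fderiv_of_isOpen hU (by simp)).clm_apply contDiffOn_const

lemma dirDeriv_congr (hU : IsOpen U) (h : Set.EqOn f g U) (v : E) :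
    Set.EqOn (dirDeriv v f) (dirDeriv v g) U := fun p hp => by
  simp only [dirDeriv, (h.eventuallyEq_of_mem (hU.mem_nhds hp)).fderiv_eq]

lemma dirDeriv_add (hf : DifferentiableAt ℝ f p) (hg : DifferentiableAt ℝ g p) :
    dirDeriv v (fun q => f q + g q) p = dirDeriv v f p + dirDeriv v g p := by
  simp [dirDeriv, fderiv_fun_add hf hg]

lemma dirDeriv_sub (hf : DifferentiableAt ℝ f p) (hg : DifferentiableAt ℝ g p) :
    dirDeriv v (fun q => f q - g q) p = dirDeriv v f p - dirDeriv v g p := by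
  simp [dirDeriv, fderiv_fun_sub hf hg]

lemma dirDeriv_mul (hf : DifferentiableAt ℝ f p) (hg : DifferentiableAt ℝ g p) :
    dirDeriv v (fun q => f q * g q) p = f p * dirDeriv v g p + g p * dirDeriv v f p := by
  simp [dirDeriv, fderiv_fun_mul hf hg]

lemma dirDeriv_sq (hf : DifferentiableAt ℝ f p) :
    dirDeriv v (fun q => f q ^ 2) p = 2 * f p * dirDeriv v f p := by
  simp only [pow_two]
  rw [dirDeriv_mul hf hf]
  ring

lemma dirDeriv_sum {F : ι → E → ℝ} (hF : ∀ i, DifferentiableAt ℝ (F i) p) :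
    dirDeriv v (fun q => ∑ i, F i q) p = ∑ i, dirDeriv v (F i) p := by
  simp [dirDeriv, fderiv_fun_sum fun i _ => hF i]

lemma dirDeriv_comm (hU : IsOpen U) (hf : ContDiffOn ℝ ∞ f U) (hp : p ∈ U) (v w : E) :
    dirDeriv v (dirDeriv w f) p = dirDeriv w (dirDeriv v f) p := by
  have hd : DifferentiableAt ℝ (fderiv ℝ f) p :=
    ((hf.fderiv_of_isOpen hU (m := ∞) (by simp)).contDiffAt (hU.mem_nhds hp)).differentiableAt
      (by simp)
  have key : ∀ a b : E, dirDeriv a (dirDeriv b f) p = fderiv ℝ (fderiv ℝ f) p a b := by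
    intro a b
    change fderiv ℝ (fun q => fderiv ℝ f q b) p a = _
    rw [fderiv_clm_apply hd (by fun_prop)]
    simp
  rw [key, key]
  exact ((hf.contDiffAt (hU.mem_nhds hp)).isSymmSndFDerivAt
    (by rw [minSmoothness_of_isRCLikeNormedField]; exact WithTop.coe_le_coe.2 le_top)).eq v w

lemma dirDeriv_comm_twice (hU : IsOpen U) (hf : ContDiffOn ℝ ∞ f U) (hp : p ∈ U) (v w : E) :
    dirDeriv w (dirDeriv w (dirDeriv v f)) p = dirDeriv v (dirDeriv w (dirDeriv w f)) p := by
  rw [dirDeriv_congr hU (fun q hq => dirDeriv_comm hU hf hq w v) w hp,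
    dirDeriv_comm hU (dirDeriv_smoothOn hU hf w) hp w v]

/-- If `∂_τ f = ∑ ∂_i ∂_i f + ∑ (∂_i f)²`, then the Li–Yau quantity
`G = ½ ∑ (∂_i f)² - ∂_τ f` satisfies `∂_τ G - Δ G - 2 ∇ f · ∇ G = -|D² f|²`. -/
lemma liYau_evolution (hU : IsOpen U) (hf : ContDiffOn ℝ ∞ f U) (e : ι → E) (τ : E)
    (heq : ∀ q ∈ U, dirDeriv τ f q =
      (∑ i, dirDeriv (e i) (dirDeriv (e i) f) q) + ∑ i, dirDeriv (e i) f q ^ 2)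
    (hG : g = fun q => (1 / 2) * (∑ i, dirDeriv (e i) f q ^ 2) - dirDeriv τ f q) (hp : p ∈ U) :
    dirDeriv τ g p - (∑ j, dirDeriv (e j) (dirDeriv (e j) g) p)
      - 2 * ∑ j, dirDeriv (e j) f p * dirDeriv (e j) g p
      = - ∑ j, ∑ i, dirDeriv (e j) (dirDeriv (e i) f) p ^ 2 := by
  have hF : ∀ v, ContDiffOn ℝ ∞ (dirDeriv v f) U := dirDeriv_smoothOn hU hf
  have hFF : ∀ v w, ContDiffOn ℝ ∞ (dirDeriv v (dirDeriv w f)) U :=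
    fun v w => dirDeriv_smoothOn hU (hF w) v
  have dF : ∀ v, ∀ q ∈ U, DifferentiableAt ℝ (dirDeriv v f) q :=
    fun v q hq => differentiableAt_of_smoothOn hU (hF v) hq
  have dFF : ∀ v w, ∀ q ∈ U, DifferentiableAt ℝ (dirDeriv v (dirDeriv w f)) q :=
    fun v w q hq => differentiableAt_of_smoothOn hU (hFF v w) hq
  have dsq : ∀ v, ∀ q ∈ U, dirDeriv v (fun q => ∑ i, dirDeriv (e i) f q ^ 2) q =
      ∑ i, 2 * dirDeriv (e i) f q * dirDeriv v (dirDeriv (e i) f) q := by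
    intro v q hq
    rw [dirDeriv_sum (F := fun i q => dirDeriv (e i) f q ^ 2) (fun i => (dF (e i) q hq).pow 2)]
    exact Finset.sum_congr rfl fun i _ => dirDeriv_sq (dF _ q hq)
  have dsum : ∀ q ∈ U, DifferentiableAt ℝ (fun q => ∑ i, dirDeriv (e i) f q ^ 2) q :=
    fun q hq => DifferentiableAt.fun_sum fun i _ => (dF (e i) q hq).pow 2
  have g1 : ∀ v, Set.EqOn (dirDeriv v g) (fun q =>
      (∑ i, dirDeriv (e i) f q * dirDeriv v (dirDeriv (e i) f) q)
        - dirDeriv v (dirDeriv τ f) q) U := by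
    intro v q hq
    rw [hG]
    simp only
    rw [dirDeriv_sub ((dsum q hq).const_mul _) (dF τ q hq),
      dirDeriv_mul (differentiableAt_const _) (dsum q hq), dsq v q hq]
    simp only [dirDeriv, fderiv_const_apply, zero_apply, mul_zero, add_zero,
      Finset.mul_sum, sub_left_inj]
    exact Finset.sum_congr rfl fun i _ => by ring
  have g2 : ∀ j, dirDeriv (e j) (dirDeriv (e j) g) p =
      (∑ i, (dirDeriv (e i) f p * dirDeriv (e i) (dirDeriv (e j) (dirDeriv (e j) f)) p
        + dirDeriv (e j) (dirDeriv (e i) f) p ^ 2))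
        - dirDeriv τ (dirDeriv (e j) (dirDeriv (e j) f)) p := by
    intro j
    have dm : ∀ i, DifferentiableAt ℝ
        (fun q => dirDeriv (e i) f q * dirDeriv (e j) (dirDeriv (e i) f) q) p :=
      fun i => (dF (e i) p hp).mul (dFF (e j) (e i) p hp)
    rw [dirDeriv_congr hU (g1 (e j)) (e j) hp, dirDeriv_sub
      (DifferentiableAt.fun_sum fun i _ => dm i) (dFF _ _ p hp), dirDeriv_sum dm,
      dirDeriv_comm_twice hU hf hp]
    congr 1
    refine Finset.sum_congr rfl fun i _ => ?_
    rw [dirDeriv_mul (dF _ p hp) (dFF _ _ p hp), dirDeriv_comm_twice hU hf hp]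
    ring
  have lapD : ∀ v, ∑ j, dirDeriv v (dirDeriv (e j) (dirDeriv (e j) f)) p =
      dirDeriv v (dirDeriv τ f) p
        - ∑ i, 2 * dirDeriv (e i) f p * dirDeriv v (dirDeriv (e i) f) p := by
    intro v
    rw [← dirDeriv_sum (fun j => dFF _ _ p hp), ← dsq v p hp,
      ← dirDeriv_sub (dF τ p hp) (dsum p hp)]
    exact dirDeriv_congr hU (fun q hq => by simp only [heq q hq]; ring) v hp
  have s1 : ∑ j, dirDeriv (e j) (dirDeriv (e j) g) p =
      (∑ i, dirDeriv (e i) f p * (dirDeriv (e i) (dirDeriv τ f) p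
        - ∑ j, 2 * dirDeriv (e j) f p * dirDeriv (e i) (dirDeriv (e j) f) p))
      + (∑ j, ∑ i, dirDeriv (e j) (dirDeriv (e i) f) p ^ 2)
      - (dirDeriv τ (dirDeriv τ f) p
        - ∑ i, 2 * dirDeriv (e i) f p * dirDeriv τ (dirDeriv (e i) f) p) := by
    simp only [g2, Finset.sum_sub_distrib, Finset.sum_add_distrib, lapD, sub_left_inj,
      add_left_inj]
    rw [Finset.sum_comm]
    exact Finset.sum_congr rfl fun i _ => by rw [← lapD, Finset.mul_sum]
  have s2 : ∑ j, dirDeriv (e j) f p * dirDeriv (e j) g p =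
      (∑ i, dirDeriv (e i) f p *
        ∑ j, dirDeriv (e j) f p * dirDeriv (e i) (dirDeriv (e j) f) p)
      - ∑ i, dirDeriv (e i) f p * dirDeriv (e i) (dirDeriv τ f) p := by
    rw [← Finset.sum_sub_distrib]
    exact Finset.sum_congr rfl fun i _ => by rw [g1 _ hp]; ring
  rw [s1, s2, g1 τ hp]
  simp only [dirDeriv_comm hU hf hp τ (e _), mul_assoc, ← Finset.mul_sum, mul_sub,
    Finset.sum_sub_distrib, mul_left_comm _ (2 : ℝ)]
  ring

/-- Along a line, a smooth function has vanishing first and nonpositive second derivative at a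
local maximum. -/
lemma dirDeriv_of_isLocalMax_line (hU : IsOpen U) (hf : ContDiffOn ℝ ∞ f U) (hp : p ∈ U) (v : E)
    (hmax : IsLocalMax (fun h : ℝ => f (p + h • v)) 0) :
    dirDeriv v f p = 0 ∧ dirDeriv v (dirDeriv v f) p ≤ 0 := by
  have hline : ∀ h : ℝ, HasDerivAt (fun h : ℝ => p + h • v) v h := fun h => by
    simpa using ((hasDerivAt_id h).smul_const v).const_add p
  have hder : ∀ k : E → ℝ, ContDiffOn ℝ ∞ k U → ∀ h : ℝ, p + h • v ∈ U →
      HasDerivAt (fun h : ℝ => k (p + h • v)) (dirDeriv v k (p + h • v)) h := fun k hk h hh =>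
    ((differentiableAt_of_smoothOn hU hk hh).hasFDerivAt).comp_hasDerivAt h (hline h)
  have hev : ∀ᶠ h : ℝ in nhds 0, p + h • v ∈ U :=
    (hline 0).continuousAt.eventually (by simpa using hU.mem_nhds hp)
  have h0 : p + (0 : ℝ) • v ∈ U := by simpa using hp
  have d1 : deriv (fun h : ℝ => f (p + h • v)) =ᶠ[nhds 0] fun h => dirDeriv v f (p + h • v) :=
    hev.mono fun h hh => (hder f hf h hh).deriv
  have d2 : deriv (deriv fun h : ℝ => f (p + h • v)) 0 = dirDeriv v (dirDeriv v f) p := by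
    rw [d1.deriv_eq, (hder _ (dirDeriv_smoothOn hU hf v) 0 h0).deriv]
    simp
  have z : deriv (fun h : ℝ => f (p + h • v)) 0 = 0 := hmax.deriv_eq_zero
  refine ⟨by simpa using d1.self_of_nhds.symm.trans z, ?_⟩
  by_contra! hpos
  have hmin := isLocalMin_of_deriv_deriv_pos (d2 ▸ hpos) z (hder f hf 0 h0).continuousAt
  have hconst : (fun h : ℝ => f (p + h • v)) =ᶠ[nhds 0] fun _ => f (p + (0 : ℝ) • v) := by
    filter_upwards [hmax, hmin] with h h1 h2 using le_antisymm h1 h2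
  have := hconst.deriv.deriv_eq
  rw [d2] at this
  simp at this
  exact hpos.ne' this

end DirectionalDerivative

section Cutoff

variable {n : ℕ} {x : EuclideanSpace ℝ (Fin n)} {t₀ s₁ ρ : ℝ}
  {p : EuclideanSpace ℝ (Fin n) × ℝ}

/-- The `i`-th spatial unit vector of space-time. -/
def spaceDir (n : ℕ) (i : Fin n) : EuclideanSpace ℝ (Fin n) × ℝ := (EuclideanSpace.single i 1, 0)

/-- The unit time vector of space-time. -/
def timeDir (n : ℕ) : EuclideanSpace ℝ (Fin n) × ℝ := (0, 1)

/-- The factor `1 - |y - x|² / ρ²`, vanishing on the lateral boundary. -/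
def bump (x : EuclideanSpace ℝ (Fin n)) (ρ : ℝ) (p : EuclideanSpace ℝ (Fin n) × ℝ) : ℝ :=
  1 - ‖p.1 - x‖ ^ 2 / ρ ^ 2

/-- The affine function of time equal to `0` at `t₀` and `1` at `s₁`. -/
def ramp (n : ℕ) (t₀ s₁ : ℝ) (p : EuclideanSpace ℝ (Fin n) × ℝ) : ℝ := (p.2 - t₀) / (s₁ - t₀)

/-- A cutoff function vanishing on the parabolic boundary of a cylinder. -/
def cutoff (x : EuclideanSpace ℝ (Fin n)) (t₀ s₁ ρ : ℝ) (p : EuclideanSpace ℝ (Fin n) × ℝ) : ℝ :=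
  ramp n t₀ s₁ p * bump x ρ p ^ 2

lemma bump_contDiff : ContDiff ℝ ∞ (bump x ρ) :=
  contDiff_const.sub (((contDiff_fst.sub contDiff_const).norm_sq ℝ).div_const _)

lemma ramp_contDiff : ContDiff ℝ ∞ (ramp n t₀ s₁) :=
  (contDiff_snd.sub contDiff_const).div_const _

lemma cutoff_contDiff : ContDiff ℝ ∞ (cutoff x t₀ s₁ ρ) :=
  ramp_contDiff.mul (bump_contDiff.pow 2)

lemma bump_differentiableAt : DifferentiableAt ℝ (bump x ρ) p :=
  bump_contDiff.contDiffAt.differentiableAt (by simp)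

lemma ramp_differentiableAt : DifferentiableAt ℝ (ramp n t₀ s₁) p :=
  ramp_contDiff.contDiffAt.differentiableAt (by simp)

lemma bump_hasFDerivAt : HasFDerivAt (bump x ρ)
    (-((ρ ^ 2)⁻¹ • (2 • (innerSL ℝ (p.1 - x)).comp (ContinuousLinearMap.fst ℝ _ ℝ)))) p := by
  have := ((((hasFDerivAt_fst (𝕜 := ℝ) (p := p)).sub_const x).norm_sq).const_mul
    (ρ ^ 2)⁻¹).const_sub 1
  refine this.congr_of_eventuallyEq (Filter.Eventually.of_forall fun q => ?_)
  simp [bump, div_eq_inv_mul]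

lemma ramp_hasFDerivAt : HasFDerivAt (ramp n t₀ s₁)
    ((s₁ - t₀)⁻¹ • ContinuousLinearMap.snd ℝ _ ℝ) p := by
  have := ((hasFDerivAt_snd (𝕜 := ℝ) (p := p)).sub_const t₀).const_mul (s₁ - t₀)⁻¹
  refine this.congr_of_eventuallyEq (Filter.Eventually.of_forall fun q => ?_)
  simp [ramp, div_eq_inv_mul]

lemma dirDeriv_spaceDir_bump (i : Fin n) :
    dirDeriv (spaceDir n i) (bump x ρ) p = -2 / ρ ^ 2 * (p.1 i - x i) := by
  rw [dirDeriv, bump_hasFDerivAt.fderiv]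
  simp [spaceDir, EuclideanSpace.inner_single_right]
  ring

lemma dirDeriv_timeDir_bump : dirDeriv (timeDir n) (bump x ρ) p = 0 := by
  rw [dirDeriv, bump_hasFDerivAt.fderiv]
  simp [timeDir]

lemma dirDeriv_spaceDir_ramp (i : Fin n) : dirDeriv (spaceDir n i) (ramp n t₀ s₁) p = 0 := by
  rw [dirDeriv, ramp_hasFDerivAt.fderiv]
  simp [spaceDir]

lemma dirDeriv_timeDir_ramp : dirDeriv (timeDir n) (ramp n t₀ s₁) p = (s₁ - t₀)⁻¹ := by
  rw [dirDeriv, ramp_hasFDerivAt.fderiv]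
  simp [timeDir]

lemma dirDeriv_spaceDir_coord (i : Fin n) (c d : ℝ) :
    dirDeriv (spaceDir n i) (fun q => c * (q.1 i - d)) p = c := by
  have h : HasFDerivAt (fun q : EuclideanSpace ℝ (Fin n) × ℝ => q.1 i)
      ((EuclideanSpace.proj i : EuclideanSpace ℝ (Fin n) →L[ℝ] ℝ).comp
        (ContinuousLinearMap.fst ℝ _ ℝ)) p :=
    ((EuclideanSpace.proj i : EuclideanSpace ℝ (Fin n) →L[ℝ] ℝ).comp
      (ContinuousLinearMap.fst ℝ _ ℝ)).hasFDerivAt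
  rw [dirDeriv, ((h.sub_const d).const_mul c).fderiv]
  simp [spaceDir]

lemma dirDeriv_timeDir_cutoff :
    dirDeriv (timeDir n) (cutoff x t₀ s₁ ρ) p = bump x ρ p ^ 2 * (s₁ - t₀)⁻¹ := by
  unfold cutoff
  rw [dirDeriv_mul ramp_differentiableAt (bump_differentiableAt.fun_pow 2),
    dirDeriv_sq bump_differentiableAt, dirDeriv_timeDir_bump, dirDeriv_timeDir_ramp]
  ring

lemma dirDeriv_spaceDir_cutoff (i : Fin n) :
    dirDeriv (spaceDir n i) (cutoff x t₀ s₁ ρ) = fun q =>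
      ramp n t₀ s₁ q * (bump x ρ q * (-4 / ρ ^ 2 * (q.1 i - x i))) := by
  funext q
  unfold cutoff
  rw [dirDeriv_mul ramp_differentiableAt (bump_differentiableAt.fun_pow 2),
    dirDeriv_sq bump_differentiableAt, dirDeriv_spaceDir_bump, dirDeriv_spaceDir_ramp]
  ring

lemma dirDeriv_spaceDir_twice_cutoff (i : Fin n) :
    dirDeriv (spaceDir n i) (dirDeriv (spaceDir n i) (cutoff x t₀ s₁ ρ)) p =
      ramp n t₀ s₁ p * (8 / ρ ^ 4 * (p.1 i - x i) ^ 2 - 4 / ρ ^ 2 * bump x ρ p) := by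
  have hc : DifferentiableAt ℝ (fun q : EuclideanSpace ℝ (Fin n) × ℝ =>
      -4 / ρ ^ 2 * (q.1 i - x i)) p := by fun_prop
  rw [dirDeriv_spaceDir_cutoff,
    dirDeriv_mul ramp_differentiableAt (bump_differentiableAt.fun_mul hc),
    dirDeriv_mul bump_differentiableAt hc, dirDeriv_spaceDir_bump, dirDeriv_spaceDir_ramp,
    dirDeriv_spaceDir_coord]
  ring

lemma cutoff_nonneg (h : t₀ < s₁) (hp : p.2 ∈ Set.Icc t₀ s₁) : 0 ≤ cutoff x t₀ s₁ ρ p :=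
  mul_nonneg (div_nonneg (by linarith [hp.1]) (by linarith)) (sq_nonneg _)

lemma ramp_mem_Icc (h : t₀ < s₁) (hp : p.2 ∈ Set.Icc t₀ s₁) :
    ramp n t₀ s₁ p ∈ Set.Icc (0 : ℝ) 1 :=
  ⟨div_nonneg (by linarith [hp.1]) (by linarith),
    (div_le_one (by linarith)).2 (by linarith [hp.2])⟩

lemma bump_mem_Icc (hρ : 0 < ρ) (hp : dist p.1 x ≤ ρ) : bump x ρ p ∈ Set.Icc (0 : ℝ) 1 := by
  rw [dist_eq_norm] at hp
  have h1 : ‖p.1 - x‖ ^ 2 / ρ ^ 2 ≤ 1 := by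
    rw [div_le_one (by positivity)]
    gcongr
  have h2 : 0 ≤ ‖p.1 - x‖ ^ 2 / ρ ^ 2 := by positivity
  exact ⟨by unfold bump; linarith, by unfold bump; linarith⟩

lemma sum_sq_dirDeriv_cutoff_le (hρ : 0 < ρ) (h : t₀ < s₁) (hp : p.2 ∈ Set.Icc t₀ s₁)
    (hx : dist p.1 x ≤ ρ) :
    ∑ i, dirDeriv (spaceDir n i) (cutoff x t₀ s₁ ρ) p ^ 2 ≤
      16 * cutoff x t₀ s₁ ρ p / ρ ^ 2 := by
  obtain ⟨ht0, ht1⟩ := ramp_mem_Icc (n := n) h hp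
  have hr : ‖p.1 - x‖ ^ 2 ≤ ρ ^ 2 := by
    rw [dist_eq_norm] at hx
    gcongr
  have e : ∑ i, dirDeriv (spaceDir n i) (cutoff x t₀ s₁ ρ) p ^ 2 =
      16 / ρ ^ 4 * bump x ρ p ^ 2 * (ramp n t₀ s₁ p * (ramp n t₀ s₁ p * ‖p.1 - x‖ ^ 2)) := by
    simp only [dirDeriv_spaceDir_cutoff, EuclideanSpace.real_norm_sq_eq, Finset.mul_sum]
    refine Finset.sum_congr rfl fun i _ => ?_
    simp only [PiLp.sub_apply]
    ring
  rw [e]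
  calc _ ≤ 16 / ρ ^ 4 * bump x ρ p ^ 2 * (ramp n t₀ s₁ p * (1 * ρ ^ 2)) := by gcongr
    _ = 16 * cutoff x t₀ s₁ ρ p / ρ ^ 2 := by
      unfold cutoff
      field_simp

lemma neg_laplacian_cutoff_le (hρ : 0 < ρ) (h : t₀ < s₁) (hp : p.2 ∈ Set.Icc t₀ s₁)
    (hx : dist p.1 x ≤ ρ) :
    -∑ i, dirDeriv (spaceDir n i) (dirDeriv (spaceDir n i) (cutoff x t₀ s₁ ρ)) p ≤
      4 * n / ρ ^ 2 := by
  obtain ⟨ht0, ht1⟩ := ramp_mem_Icc (n := n) h hp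
  obtain ⟨hb0, hb1⟩ := bump_mem_Icc hρ hx
  have key : ∀ i ∈ Finset.univ (α := Fin n),
      -dirDeriv (spaceDir n i) (dirDeriv (spaceDir n i) (cutoff x t₀ s₁ ρ)) p ≤ 4 / ρ ^ 2 := by
    intro i _
    rw [dirDeriv_spaceDir_twice_cutoff]
    have h1 : 0 ≤ ramp n t₀ s₁ p * (8 / ρ ^ 4 * (p.1 i - x i) ^ 2) := by positivity
    have h2 : ramp n t₀ s₁ p * (4 / ρ ^ 2 * bump x ρ p) ≤ 1 * (4 / ρ ^ 2 * 1) := by gcongr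
    linarith
  rw [← Finset.sum_neg_distrib]
  refine (Finset.sum_le_sum key).trans (le_of_eq ?_)
  simp
  ring

lemma timeDeriv_cutoff_le (hρ : 0 < ρ) (h : t₀ < s₁) (hx : dist p.1 x ≤ ρ) :
    dirDeriv (timeDir n) (cutoff x t₀ s₁ ρ) p ≤ 1 / (s₁ - t₀) := by
  obtain ⟨hb0, hb1⟩ := bump_mem_Icc hρ hx
  have : 0 < s₁ - t₀ := by linarith
  rw [dirDeriv_timeDir_cutoff, one_div]
  exact mul_le_of_le_one_left (by positivity) (pow_le_one₀ hb0 hb1)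

end Cutoff

/-- The algebraic inequality behind the Li–Yau estimate at a positive maximum of `φ G`. Here `D`
is the squared Hessian norm, `w = |∇f|²`, `X = ∇f · ∇φ`, `S = |∇φ|²` and `c` bounds
`∂_t φ - Δ φ`. -/
lemma liYau_maximum_algebra {N φ G w D X S c r : ℝ} (hN : 0 ≤ N) (hφ : 0 < φ) (hG : 0 < G)
    (hr : 0 < r) (hw : 0 ≤ w) (hD : (G + w / 2) ^ 2 ≤ N * D) (hX : X ^ 2 ≤ w * S)
    (hS : S ≤ 16 * φ / r ^ 2)
    (hmax : 0 ≤ -2 * (φ * G) * X - φ ^ 2 * D + φ * G * c + 2 * G * S) :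
    φ * G ≤ N * c + (32 * N + 16 * N ^ 2) / r ^ 2 := by
  have hH : 0 < φ * G := mul_pos hφ hG
  have hGS : 2 * G * S ≤ φ * G * (32 / r ^ 2) :=
    (mul_le_mul_of_nonneg_left hS (by positivity)).trans_eq (by ring)
  have hmain : φ * G + φ * w ≤ N * (-2 * X + c + 32 / r ^ 2) := by
    refine le_of_mul_le_mul_left ?_ hH
    have h1 := mul_le_mul_of_nonneg_left hD (sq_nonneg φ)
    have h2 : N * (φ ^ 2 * D) ≤ N * (φ * G * (-2 * X + c + 32 / r ^ 2)) :=
      mul_le_mul_of_nonneg_left (by linarith) hN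
    have h3 : 0 ≤ φ ^ 2 * w ^ 2 := by positivity
    linarith
  have hcross : -2 * N * X ≤ φ * w + 16 * N ^ 2 / r ^ 2 := by
    have hb : 0 ≤ φ * w + 16 * N ^ 2 / r ^ 2 := by positivity
    refine (abs_le_of_sq_le_sq' ?_ hb).2
    calc (-2 * N * X) ^ 2 = 4 * N ^ 2 * X ^ 2 := by ring
      _ ≤ 4 * N ^ 2 * (w * (16 * φ / r ^ 2)) := by
        gcongr
        exact hX.trans (by gcongr)
      _ = 4 * (φ * w) * (16 * N ^ 2 / r ^ 2) := by ring
      _ ≤ _ := four_mul_le_sq_add _ _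
  have e : (32 * N + 16 * N ^ 2) / r ^ 2 = N * (32 / r ^ 2) + 16 * N ^ 2 / r ^ 2 := by ring
  linarith

/-- The interior Li–Yau estimate for `f = log u`, with explicit constants. -/
lemma liYau_interior {n : ℕ} {U : Set (EuclideanSpace ℝ (Fin n) × ℝ)} (hU : IsOpen U)
    {f : EuclideanSpace ℝ (Fin n) × ℝ → ℝ} (hf : ContDiffOn ℝ ∞ f U)
    (heq : ∀ q ∈ U, dirDeriv (timeDir n) f q =
      (∑ i, dirDeriv (spaceDir n i) (dirDeriv (spaceDir n i) f) q)
        + ∑ i, dirDeriv (spaceDir n i) f q ^ 2)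
    {x : EuclideanSpace ℝ (Fin n)} {t₀ s₁ ρ : ℝ} (hρ : 0 < ρ) (ht : t₀ < s₁)
    (hK : Metric.closedBall x ρ ×ˢ Set.Icc t₀ s₁ ⊆ U) :
    (1 / 2) * (∑ i, dirDeriv (spaceDir n i) f (x, s₁) ^ 2) - dirDeriv (timeDir n) f (x, s₁) ≤
      n / (s₁ - t₀) + (32 * n + 20 * n ^ 2) / ρ ^ 2 := by
  have hT : 0 < s₁ - t₀ := sub_pos.2 ht
  obtain ⟨g, hg⟩ : ∃ g : EuclideanSpace ℝ (Fin n) × ℝ → ℝ, g = fun q =>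
    (1 / 2) * (∑ i, dirDeriv (spaceDir n i) f q ^ 2) - dirDeriv (timeDir n) f q := ⟨_, rfl⟩
  have hgU : ContDiffOn ℝ ∞ g U := hg ▸ (contDiffOn_const.mul
    (ContDiffOn.sum fun i _ => (dirDeriv_smoothOn hU hf (spaceDir n i)).pow 2)).sub
      (dirDeriv_smoothOn hU hf (timeDir n))
  obtain ⟨φ, hφ⟩ : ∃ φ : EuclideanSpace ℝ (Fin n) × ℝ → ℝ, φ = cutoff x t₀ s₁ ρ := ⟨_, rfl⟩
  have hφU : ContDiffOn ℝ ∞ φ U := hφ ▸ cutoff_contDiff.contDiffOn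
  have hHU : ContDiffOn ℝ ∞ (fun q => φ q * g q) U := hφU.mul hgU
  obtain ⟨p, hpK, hpmax⟩ := ((isCompact_closedBall x ρ).prod isCompact_Icc).exists_isMaxOn
    ⟨(x, s₁), Metric.mem_closedBall_self hρ.le, ht.le, le_rfl⟩ (hHU.continuousOn.mono hK)
  have htop : φ (x, s₁) * g (x, s₁) ≤ φ p * g p :=
    hpmax ⟨Metric.mem_closedBall_self hρ.le, ht.le, le_rfl⟩
  have hφtop : φ (x, s₁) = 1 := by simp [hφ, cutoff, ramp, bump, hT.ne']
  have hgoal : g (x, s₁) ≤ n / (s₁ - t₀) + (32 * n + 20 * n ^ 2) / ρ ^ 2 := by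
    rw [hφtop, one_mul] at htop
    refine htop.trans ?_
    rcases le_or_gt (φ p * g p) 0 with hneg | hpos
    · exact hneg.trans (by positivity)
    have hpU : p ∈ U := hK hpK
    obtain ⟨hpx, hpt⟩ := hpK
    have hφ0 : 0 ≤ φ p := hφ ▸ cutoff_nonneg ht hpt
    have hφp : 0 < φ p := hφ0.lt_of_ne fun h => by simp [← h] at hpos
    have hgp : 0 < g p := pos_of_mul_pos_right hpos hφ0
    have hball : dist p.1 x < ρ := by
      refine lt_of_le_of_ne hpx fun h => hφp.ne' ?_
      have : ‖p.1 - x‖ = ρ := by rw [← dist_eq_norm, h]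
      simp [hφ, cutoff, bump, this, hρ.ne']
    have htime : t₀ < p.2 := by
      refine lt_of_le_of_ne hpt.1 fun h => hφp.ne' ?_
      simp [hφ, cutoff, ramp, h]
    have dφ : ∀ q ∈ U, DifferentiableAt ℝ φ q := fun q hq => differentiableAt_of_smoothOn hU hφU hq
    have dg : ∀ q ∈ U, DifferentiableAt ℝ g q := fun q hq => differentiableAt_of_smoothOn hU hgU hq
    have hmul : ∀ v, Set.EqOn (dirDeriv v fun q => φ q * g q)
        (fun q => φ q * dirDeriv v g q + g q * dirDeriv v φ q) U :=
      fun v q hq => dirDeriv_mul (dφ q hq) (dg q hq)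
    have hspace : ∀ i, dirDeriv (spaceDir n i) (fun q => φ q * g q) p = 0 ∧
        dirDeriv (spaceDir n i) (dirDeriv (spaceDir n i) fun q => φ q * g q) p ≤ 0 := by
      intro i
      refine dirDeriv_of_isLocalMax_line hU hHU hpU _ ?_
      have hcont : Continuous fun h : ℝ => (p + h • spaceDir n i).1 := by fun_prop
      filter_upwards [hcont.continuousAt.eventually
        (Metric.isOpen_ball.mem_nhds (by simpa using hball : (p + (0 : ℝ) • spaceDir n i).1 ∈
          Metric.ball x ρ))] with h hh
      simp only [zero_smul, add_zero]
      exact hpmax ⟨Metric.ball_subset_closedBall hh, by simpa [spaceDir] using hpt⟩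
    have htimeDeriv : 0 ≤ dirDeriv (timeDir n) (fun q => φ q * g q) p := by
      have hcone : (t₀ - p.2) • timeDir n ∈
          posTangentConeAt (Metric.closedBall x ρ ×ˢ Set.Icc t₀ s₁) p := by
        refine mem_posTangentConeAt_of_segment_subset ?_
        refine ((convex_closedBall x ρ).prod (convex_Icc t₀ s₁)).segment_subset ⟨hpx, hpt⟩ ?_
        simpa [timeDir, ht.le] using hpx
      have := hpmax.localize.hasFDerivWithinAt_nonpos
        (differentiableAt_of_smoothOn hU hHU hpU).hasFDerivAt.hasFDerivWithinAt hcone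
      rw [map_smul, smul_eq_mul] at this
      exact nonneg_of_mul_nonpos_right this (by linarith)
    have hgrad : ∀ i, φ p * dirDeriv (spaceDir n i) g p =
        - (g p * dirDeriv (spaceDir n i) φ p) := fun i => by
      have := (hspace i).1
      rw [hmul _ hpU] at this
      linarith
    have hlap : ∀ i, φ p * (φ p * dirDeriv (spaceDir n i) (dirDeriv (spaceDir n i) g) p)
        ≤ 2 * g p * dirDeriv (spaceDir n i) φ p ^ 2
          - φ p * g p * dirDeriv (spaceDir n i) (dirDeriv (spaceDir n i) φ) p := by
      intro i
      have h := (hspace i).2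
      have s1 := dirDeriv_smoothOn hU hgU (spaceDir n i)
      have s2 := dirDeriv_smoothOn hU hφU (spaceDir n i)
      have d1 := differentiableAt_of_smoothOn hU s1 hpU
      have d2 := differentiableAt_of_smoothOn hU s2 hpU
      rw [dirDeriv_congr hU (hmul _) _ hpU,
        dirDeriv_add ((dφ p hpU).fun_mul d1) ((dg p hpU).fun_mul d2),
        dirDeriv_mul (dφ p hpU) d1, dirDeriv_mul (dg p hpU) d2] at h
      have h' := mul_le_mul_of_nonneg_left h hφ0
      linear_combination h' - 2 * dirDeriv (spaceDir n i) φ p * hgrad i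
    have hlapsum := Finset.sum_le_sum fun i (_ : i ∈ Finset.univ) => hlap i
    simp only [← Finset.mul_sum, Finset.sum_sub_distrib] at hlapsum
    have hinner : φ p * ∑ i, dirDeriv (spaceDir n i) f p * dirDeriv (spaceDir n i) g p =
        - (g p * ∑ i, dirDeriv (spaceDir n i) f p * dirDeriv (spaceDir n i) φ p) := by
      rw [Finset.mul_sum, Finset.mul_sum, ← Finset.sum_neg_distrib]
      refine Finset.sum_congr rfl fun i _ => ?_
      linear_combination dirDeriv (spaceDir n i) f p * hgrad i
    have hevol := liYau_evolution hU hf (spaceDir n) (timeDir n) heq hg hpU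
    have htime' : 0 ≤ φ p * (φ p * dirDeriv (timeDir n) g p + g p * dirDeriv (timeDir n) φ p) := by
      rw [hmul _ hpU] at htimeDeriv
      exact mul_nonneg hφ0 htimeDeriv
    have hc : dirDeriv (timeDir n) φ p
        - ∑ i, dirDeriv (spaceDir n i) (dirDeriv (spaceDir n i) φ) p
        ≤ 1 / (s₁ - t₀) + 4 * n / ρ ^ 2 := by
      have h1 := timeDeriv_cutoff_le hρ ht hpx
      have h2 := neg_laplacian_cutoff_le hρ ht hpt hpx
      rw [hφ]
      linarith
    have hc' := mul_le_mul_of_nonneg_left hc hpos.le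
    have hD : (g p + (∑ i, dirDeriv (spaceDir n i) f p ^ 2) / 2) ^ 2 ≤
        n * ∑ j, ∑ i, dirDeriv (spaceDir n j) (dirDeriv (spaceDir n i) f) p ^ 2 := by
      have e : (g p + (∑ i, dirDeriv (spaceDir n i) f p ^ 2) / 2) ^ 2 =
          (∑ i, dirDeriv (spaceDir n i) (dirDeriv (spaceDir n i) f) p) ^ 2 := by
        rw [hg]
        simp only [heq p hpU]
        ring
      rw [e]
      refine sq_sum_le_card_mul_sum_sq.trans ?_
      simp only [Finset.card_univ, Fintype.card_fin]
      gcongr with j _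
      exact Finset.single_le_sum
        (f := fun i => dirDeriv (spaceDir n j) (dirDeriv (spaceDir n i) f) p ^ 2)
        (fun i _ => sq_nonneg _) (Finset.mem_univ j)
    have hS := sum_sq_dirDeriv_cutoff_le hρ ht hpt hpx
    rw [← hφ] at hS
    refine (liYau_maximum_algebra (c := 1 / (s₁ - t₀) + 4 * n / ρ ^ 2) n.cast_nonneg hφp hgp hρ
      (Finset.sum_nonneg fun i _ => sq_nonneg _) hD
      (Finset.sum_mul_sq_le_sq_mul_sq Finset.univ _ _) hS ?_).trans (le_of_eq (by ring))
    linear_combination htime' + hlapsum + hc' + φ p ^ 2 * hevol + 2 * φ p * hinner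
  rwa [hg] at hgoal

lemma dirDeriv_log {E : Type*} [NormedAddCommGroup E] [NormedSpace ℝ E] {u : E → ℝ} {p v : E}
    (hu : DifferentiableAt ℝ u p) (hp : u p ≠ 0) :
    dirDeriv v (fun q => Real.log (u q)) p = dirDeriv v u p / u p := by
  rw [dirDeriv, (hu.hasFDerivAt.log hp).fderiv]
  simp [dirDeriv, div_eq_inv_mul]

/-- The equation satisfied by the logarithm of a positive solution of the heat equation. -/
lemma log_heat {E ι : Type*} [NormedAddCommGroup E] [NormedSpace ℝ E] [Fintype ι] {U : Set E}
    (hU : IsOpen U) {u : E → ℝ} (hu : ContDiffOn ℝ ∞ u U) (hpos : ∀ q ∈ U, 0 < u q) (e : ι → E)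
    (τ : E) {p : E} (hp : p ∈ U)
    (heat : ∑ i, dirDeriv (e i) (dirDeriv (e i) u) p = dirDeriv τ u p) :
    dirDeriv τ (fun q => Real.log (u q)) p =
      (∑ i, dirDeriv (e i) (dirDeriv (e i) fun q => Real.log (u q)) p)
        + ∑ i, dirDeriv (e i) (fun q => Real.log (u q)) p ^ 2 := by
  have hf : ContDiffOn ℝ ∞ (fun q => Real.log (u q)) U := hu.log fun q hq => (hpos q hq).ne'
  have du := fun q (hq : q ∈ U) => differentiableAt_of_smoothOn hU hu hq
  have h1 : ∀ v, Set.EqOn (dirDeriv v u)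
      (fun q => u q * dirDeriv v (fun q => Real.log (u q)) q) U := fun v q hq => by
    simp only [dirDeriv_log (du q hq) (hpos q hq).ne']
    rw [mul_div_cancel₀ _ (hpos q hq).ne']
  have h2 : ∀ v, dirDeriv v (dirDeriv v u) p =
      u p * (dirDeriv v (dirDeriv v fun q => Real.log (u q)) p
        + dirDeriv v (fun q => Real.log (u q)) p ^ 2) := fun v => by
    rw [dirDeriv_congr hU (h1 v) v hp, dirDeriv_mul (du p hp)
      (differentiableAt_of_smoothOn hU (dirDeriv_smoothOn hU hf v) hp), h1 v hp]
    ring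
  refine mul_left_cancel₀ (hpos p hp).ne' ?_
  refine (h1 τ hp).symm.trans ?_
  rw [← heat, ← Finset.sum_add_distrib, Finset.mul_sum]
  exact Finset.sum_congr rfl fun i _ => h2 _

section Slices

variable {n : ℕ} {U : Set (EuclideanSpace ℝ (Fin n) × ℝ)} {u : EuclideanSpace ℝ (Fin n) × ℝ → ℝ}
  {p : EuclideanSpace ℝ (Fin n) × ℝ}

lemma fderiv_spaceSlice (hu : DifferentiableAt ℝ u p) (i : Fin n) :
    fderiv ℝ (fun y => u (y, p.2)) p.1 (EuclideanSpace.single i 1) =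
      dirDeriv (spaceDir n i) u p := by
  have h : HasFDerivAt (fun y => u (y, p.2)) _ p.1 :=
    HasFDerivAt.comp p.1 (g := u) (f := fun y => (y, p.2)) hu.hasFDerivAt
      (hasFDerivAt_prodMk_left p.1 p.2)
  rw [h.fderiv]
  simp [dirDeriv, spaceDir]

lemma deriv_timeSlice (hu : DifferentiableAt ℝ u p) :
    deriv (fun s => u (p.1, s)) p.2 = dirDeriv (timeDir n) u p := by
  have h : HasFDerivAt (fun s => u (p.1, s)) _ p.2 :=
    HasFDerivAt.comp p.2 (g := u) (f := fun s => (p.1, s)) hu.hasFDerivAt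
      (hasFDerivAt_prodMk_right p.1 p.2)
  rw [h.hasDerivAt.deriv]
  simp [dirDeriv, timeDir]

lemma lap_spaceSlice (hU : IsOpen U) (hu : ContDiffOn ℝ ∞ u U) (hp : p ∈ U) :
    lap n (fun y => u (y, p.2)) p.1 =
      ∑ i, dirDeriv (spaceDir n i) (dirDeriv (spaceDir n i) u) p := by
  refine Finset.sum_congr rfl fun i _ => ?_
  have hev : ∀ᶠ y in nhds p.1, (y, p.2) ∈ U :=
    (Continuous.prodMk_left p.2).continuousAt.eventually (hU.mem_nhds hp)
  have h : (fun y => fderiv ℝ (fun z => u (z, p.2)) y (EuclideanSpace.single i 1)) =ᶠ[nhds p.1]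
      fun y => dirDeriv (spaceDir n i) u (y, p.2) :=
    hev.mono fun y hy => fderiv_spaceSlice (differentiableAt_of_smoothOn hU hu hy) i
  rw [h.fderiv_eq]
  exact fderiv_spaceSlice
    (differentiableAt_of_smoothOn hU (dirDeriv_smoothOn hU hu (spaceDir n i)) hp) i

end Slices

lemma QRT_eq_prod (n : ℕ) (x : EuclideanSpace ℝ (Fin n)) (t R T : ℝ) :
    QRT n x t R T = Metric.closedBall x R ×ˢ Set.Icc (t - T) t := rfl

lemma interior_QRT (n : ℕ) (x : EuclideanSpace ℝ (Fin n)) (t T : ℝ) {R : ℝ} (hR : 0 < R) :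
    interior (QRT n x t R T) = Metric.ball x R ×ˢ Set.Ioo (t - T) t := by
  rw [QRT_eq_prod, interior_prod_eq, interior_closedBall x hR.ne', interior_Icc]

/-- The Li–Yau estimate on the axis of the cylinder, strictly below its top. -/
lemma liYau_below_top {n : ℕ} {x : EuclideanSpace ℝ (Fin n)} {t R T : ℝ} (hR : 0 < R) (hT : 0 < T)
    {u : EuclideanSpace ℝ (Fin n) × ℝ → ℝ} (hu : ContDiffOn ℝ ∞ u (QRT n x t R T))
    (hpos : ∀ p ∈ QRT n x t R T, 0 < u p)
    (heat : ∀ p ∈ interior (QRT n x t R T),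
      lap n (fun y => u (y, p.2)) p.1 = deriv (fun s => u (p.1, s)) p.2)
    {s : ℝ} (hs : s ∈ Set.Ioo (t - T / 4) t) :
    (1 / 2) * (∑ i, fderivWithin ℝ u (QRT n x t R T) (x, s) (spaceDir n i) ^ 2) / u (x, s) ^ 2
        - fderivWithin ℝ u (QRT n x t R T) (x, s) (timeDir n) / u (x, s)
      ≤ (4 * n + 4 * (32 * n + 20 * n ^ 2) + 1) * (1 / R ^ 2 + 1 / T) := by
  have hU : IsOpen (interior (QRT n x t R T)) := isOpen_interior
  have huU := hu.mono interior_subset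
  have hposU : ∀ q ∈ interior (QRT n x t R T), 0 < u q := fun q hq => hpos q (interior_subset hq)
  obtain ⟨hs1, hs2⟩ := hs
  have hxs : (x, s) ∈ interior (QRT n x t R T) := by
    rw [interior_QRT n x t T hR]
    exact ⟨Metric.mem_ball_self hR, by linarith, hs2⟩
  have hK : Metric.closedBall x (R / 2) ×ˢ Set.Icc (t - T / 2) s ⊆ interior (QRT n x t R T) := by
    rw [interior_QRT n x t T hR]
    refine Set.prod_mono (Metric.closedBall_subset_ball (by linarith)) fun r hr => ?_
    exact ⟨by linarith [hr.1], by linarith [hr.2]⟩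
  have key := liYau_interior hU (huU.log fun q hq => (hposU q hq).ne')
    (fun q hq => log_heat hU huU hposU _ _ hq (by
      rw [← lap_spaceSlice hU huU hq, heat q hq,
        deriv_timeSlice (differentiableAt_of_smoothOn hU huU hq)]))
    (half_pos hR) (by linarith) hK
  have hd := differentiableAt_of_smoothOn hU huU hxs
  have hw : fderivWithin ℝ u (QRT n x t R T) (x, s) = fderiv ℝ u (x, s) :=
    fderivWithin_of_mem_nhds (mem_interior_iff_mem_nhds.1 hxs)
  simp only [dirDeriv_log hd (hposU _ hxs).ne', div_pow, ← Finset.sum_div] at key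
  rw [hw]
  simp only [dirDeriv, ← mul_div_assoc] at key
  refine key.trans ?_
  have h1 : (n : ℝ) / (s - (t - T / 2)) ≤ n / (T / 4) :=
    div_le_div_of_nonneg_left n.cast_nonneg (by linarith) (by linarith)
  have h2 : 0 ≤ 1 / R ^ 2 := by positivity
  have h3 : 0 ≤ 1 / T := by positivity
  have h4 : 0 ≤ (n : ℝ) * (1 / R ^ 2) := by positivity
  have h5 : 0 ≤ (32 * n + 20 * (n : ℝ) ^ 2) * (1 / T) := by positivity
  have e1 : (n : ℝ) / (T / 4) = 4 * n * (1 / T) := by field_simp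
  have e2 : (32 * n + 20 * (n : ℝ) ^ 2) / (R ^ 2 / 2 ^ 2)
      = 4 * (32 * n + 20 * (n : ℝ) ^ 2) * (1 / R ^ 2) := by ring
  linarith

/-- local Li–Yau gradient estimate in `ℝⁿ`: there is `C_n` such that for
any smooth positive solution `u` of the heat equation on `Q_{R,T}(x,t)`,
`((1/2)|∇u|²/u² − u_t/u)(x,t) ≤ C_n (1/R² + 1/T)`.
Here `∇u(x,t)` is the spatial gradient and `u_t(x,t)` is the (left) time derivative
at the top time `t`. -/
theorem li_yau_local_gradient_estimate (n : ℕ) :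
    ∃ C : ℝ, 0 < C ∧
      ∀ (x : EuclideanSpace ℝ (Fin n)) (t R T : ℝ), 0 < R → 0 < T →
        ∀ u : EuclideanSpace ℝ (Fin n) × ℝ → ℝ,
          ContDiffOn ℝ (⊤ : ℕ∞) u (QRT n x t R T) →
          (∀ p ∈ QRT n x t R T, 0 < u p) →
          (∀ p ∈ interior (QRT n x t R T),
            lap n (fun y => u (y, p.2)) p.1 = deriv (fun s => u (p.1, s)) p.2) →
          (1 / 2) * ‖fderiv ℝ (fun y => u (y, t)) x‖ ^ 2 / (u (x, t)) ^ 2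
              - derivWithin (fun s => u (x, s)) (Set.Iic t) t / u (x, t) ≤
            C * (1 / R ^ 2 + 1 / T) := by
  refine ⟨4 * n + 4 * (32 * n + 20 * n ^ 2) + 1, by positivity, ?_⟩
  intro x t R T hR hT u hu hpos heat
  have hxQ : ∀ s ∈ Set.Icc (t - T) t, (x, s) ∈ QRT n x t R T :=
    fun s hs => ⟨by simpa using hR.le, hs⟩
  have htI : t ∈ Set.Icc (t - T) t := ⟨by linarith, le_rfl⟩
  have hxt := hxQ t htI
  have hdiff : HasFDerivWithinAt u (fderivWithin ℝ u (QRT n x t R T) (x, t)) (QRT n x t R T)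
      (x, t) := (hu.differentiableOn (by simp) _ hxt).hasFDerivWithinAt
  have hgrad : ‖fderiv ℝ (fun y => u (y, t)) x‖ ^ 2 =
      ∑ i, fderivWithin ℝ u (QRT n x t R T) (x, t) (spaceDir n i) ^ 2 := by
    have h : HasFDerivWithinAt (fun y => u (y, t)) _ (Metric.closedBall x R) x :=
      HasFDerivWithinAt.comp x (g := u) (f := fun y => (y, t)) hdiff
        (hasFDerivAt_prodMk_left x t).hasFDerivWithinAt fun y hy => ⟨hy, htI⟩
    rw [(h.hasFDerivAt (Metric.closedBall_mem_nhds x hR)).fderiv,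
      (EuclideanSpace.basisFun (Fin n) ℝ).norm_dual]
    simp [spaceDir]
  have htime : derivWithin (fun s => u (x, s)) (Set.Iic t) t =
      fderivWithin ℝ u (QRT n x t R T) (x, t) (timeDir n) := by
    have h : HasFDerivWithinAt (fun s => u (x, s)) _ (Set.Icc (t - T) t) t :=
      HasFDerivWithinAt.comp t (g := u) (f := fun s => (x, s)) hdiff
        (hasFDerivAt_prodMk_right x t).hasFDerivWithinAt fun s hs => hxQ s hs
    rw [(h.hasDerivWithinAt.mono_of_mem_nhdsWithin
      (Icc_mem_nhdsLE (by linarith))).derivWithin (uniqueDiffOn_Iic t t Set.self_mem_Iic)]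
    simp [timeDir]
  have hunique : UniqueDiffOn ℝ (QRT n x t R T) := by
    refine uniqueDiffOn_convex ((convex_closedBall x R).prod (convex_Icc _ _)) ?_
    rw [interior_QRT n x t T hR]
    exact ⟨(x, t - T / 2), Metric.mem_ball_self hR, by linarith, by linarith⟩
  have hmaps : Set.MapsTo (fun s : ℝ => (x, s)) (Set.Icc (t - T) t) (QRT n x t R T) := hxQ
  have hslice : ContinuousOn (fun s : ℝ => (x, s)) (Set.Icc (t - T) t) :=
    (Continuous.prodMk_right x).continuousOn
  have hcd : ContinuousOn (fun s => fderivWithin ℝ u (QRT n x t R T) (x, s))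
      (Set.Icc (t - T) t) :=
    (hu.continuousOn_fderivWithin hunique (by simp)).comp hslice hmaps
  have hcu : ContinuousOn (fun s => u (x, s)) (Set.Icc (t - T) t) :=
    hu.continuousOn.comp hslice hmaps
  have hne : ∀ s ∈ Set.Icc (t - T) t, u (x, s) ≠ 0 := fun s hs => (hpos _ (hxQ s hs)).ne'
  have hcont : ContinuousOn (fun s =>
      (1 / 2) * (∑ i, fderivWithin ℝ u (QRT n x t R T) (x, s) (spaceDir n i) ^ 2) / u (x, s) ^ 2
        - fderivWithin ℝ u (QRT n x t R T) (x, s) (timeDir n) / u (x, s)) (Set.Icc (t - T) t) :=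
    ((continuousOn_const.mul (continuousOn_finsetSum _ fun i _ =>
      (hcd.clm_apply continuousOn_const).pow 2)).div (hcu.pow 2)
        fun s hs => pow_ne_zero 2 (hne s hs)).sub
      ((hcd.clm_apply continuousOn_const).div hcu hne)
  rw [hgrad, htime]
  have hsub : Set.Ioo (t - T / 4) t ⊆ Set.Icc (t - T) t := fun s hs =>
    ⟨by linarith [hs.1], hs.2.le⟩
  have : (nhdsWithin t (Set.Ioo (t - T / 4) t)).NeBot :=
    right_nhdsWithin_Ioo_neBot (by linarith)
  exact le_of_tendsto ((hcont t htI).mono hsub)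
    (eventually_nhdsWithin_of_forall fun s hs => liYau_below_top hR hT hu hpos heat hs)
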